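/- Let X be a projective scheme over a field k, let L be an ample line bundle on X, and let s be a global section of L. Then the complement in X of the zero locus of s is an affine scheme. -/

import Mathlib

/-!
Formalization of results from "More étale covers of affine spaces in positive
characteristic" (K. Kedlaya).

Mathlib does not yet have a theory of invertible sheaves (line bundles) on schemes, so
the notions of a line bundle, its tensor powers, global sections and their vanishing
loci, and the morphism to projective space induced by a tuple of sections without common
zeros, are recorded by the structure `LineBundle` below, which axiomatises the standard
interface of these objects.  Projective space `ℙ^n_k` is taken to be `Proj` of the
polynomial ring in `n + 1` variables.
-/

open AlgebraicGeometry CategoryTheory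

attribute [local instance] MvPolynomial.gradedAlgebra

noncomputable section

universe u

/-- Projective `n`-space over `k`, as `Proj` of the polynomial ring in `n+1` variables. -/
def ProjSpace (k : Type u) [CommRing k] (n : ℕ) : Scheme.{u} :=
  Proj (MvPolynomial.homogeneousSubmodule (Fin (n + 1)) k)

/-- The canonical map from `k` to the degree-zero part of the polynomial ring. -/
def gradeZeroInclusion (k : Type u) [CommRing k] (n : ℕ) :
    k →+* ↥(MvPolynomial.homogeneousSubmodule (Fin (n + 1)) k 0) where
  toFun c := ⟨MvPolynomial.C c, MvPolynomial.isHomogeneous_C _ _⟩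
  map_one' := by ext; simp
  map_mul' x y := by ext; simp
  map_zero' := by ext; simp
  map_add' x y := by ext; simp

/-- The structure morphism of projective `n`-space over `k`. -/
def ProjSpace.structMap (k : Type u) [Field k] (n : ℕ) :
    ProjSpace k n ⟶ Spec (CommRingCat.of k) :=
  Proj.toSpecZero _ ≫ Spec.map (CommRingCat.ofHom (gradeZeroInclusion k n))

/-- The `i`-th coordinate hyperplane in `ℙ^n_k`; for `i = 0` this is the hyperplane `H`
at infinity. -/
def ProjSpace.hyperplane (k : Type u) [Field k] (n : ℕ) (i : Fin (n + 1)) :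
    Set (ProjSpace k n) :=
  ProjectiveSpectrum.zeroLocus _ {MvPolynomial.X i}

/-- The complement of the `i`-th coordinate hyperplane in `ℙ^n_k`. -/
def ProjSpace.awayFrom (k : Type u) [Field k] (n : ℕ) (i : Fin (n + 1)) :
    (ProjSpace k n).Opens :=
  Proj.basicOpen _ (MvPolynomial.X i)

variable {k : Type u} [Field k] {X : Scheme.{u}}

/-- The smooth locus of a `k`-scheme: the set of points admitting an open neighbourhood on
which the structure morphism is smooth. -/
def smoothLocus (fX : X ⟶ Spec (CommRingCat.of k)) : Set X :=
  {x | ∃ U : X.Opens, x ∈ U ∧ IsSmooth (U.ι ≫ fX)}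

/-- A `k`-scheme is geometrically reduced if its base change to an algebraic closure of `k`
is reduced. -/
def GeometricallyReduced (fX : X ⟶ Spec (CommRingCat.of k)) : Prop :=
  IsReduced (Limits.pullback fX
    (Spec.map (CommRingCat.ofHom (algebraMap k (AlgebraicClosure k)))))

/-- A scheme has pure dimension `n` if every irreducible component of it has topological
Krull dimension `n`. -/
def PureDimension (X : Scheme.{u}) (n : ℕ) : Prop :=
  ∀ Z ∈ irreducibleComponents X, topologicalKrullDim Z = (n : WithBot ℕ∞)

/-- A `k`-scheme is projective over `k` if it admits a closed immersion into some
projective space `ℙ^N_k` over `k`. -/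
def IsProjectiveOver (fX : X ⟶ Spec (CommRingCat.of k)) : Prop :=
  ∃ (N : ℕ) (g : X ⟶ ProjSpace k N), IsClosedImmersion g ∧ g ≫ ProjSpace.structMap k N = fX

/-- The data of a line bundle `L` on a `k`-scheme `X`, recorded through the modules of
global sections of its tensor powers `L^⊗l`, together with the vanishing loci of sections
and the morphisms to projective space induced by tuples of sections without common zeros.
(`sections l` plays the role of `Γ(X, L^⊗l)`, `mul` is the multiplication
`Γ(X, L^⊗a) × Γ(X, L^⊗b) → Γ(X, L^⊗(a+b))`, `one` is the canonical section `1` of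
`L^⊗0 = 𝒪_X`, and `inducedMap s h` is the morphism `x ↦ [s 0 (x) : ⋯ : s n (x)]`.) -/
structure LineBundle (fX : X ⟶ Spec (CommRingCat.of k)) : Type (u + 1) where
  sections : ℕ → Type u
  [instAddCommGroup : ∀ l, AddCommGroup (sections l)]
  [instModule : ∀ l, Module Γ(X, ⊤) (sections l)]
  one : sections 0
  mul : ∀ {a b : ℕ}, sections a → sections b → sections (a + b)
  zeroLocus : ∀ {l : ℕ}, sections l → Set X
  zeroLocus_closed : ∀ {l : ℕ} (s : sections l), IsClosed (zeroLocus s)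
  zeroLocus_one : zeroLocus one = ∅
  zeroLocus_zero : ∀ l : ℕ, zeroLocus (0 : sections l) = Set.univ
  zeroLocus_mul : ∀ {a b : ℕ} (s : sections a) (t : sections b),
    zeroLocus (mul s t) = zeroLocus s ∪ zeroLocus t
  inducedMap : ∀ {l n : ℕ} (s : Fin (n + 1) → sections l),
    (⋂ i, zeroLocus (s i)) = ∅ → (X ⟶ ProjSpace k n)
  inducedMap_over : ∀ {l n : ℕ} (s : Fin (n + 1) → sections l)
    (h : (⋂ i, zeroLocus (s i)) = ∅),
    inducedMap s h ≫ ProjSpace.structMap k n = fX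
  inducedMap_preimage : ∀ {l n : ℕ} (s : Fin (n + 1) → sections l)
    (h : (⋂ i, zeroLocus (s i)) = ∅) (i : Fin (n + 1)),
    (inducedMap s h).base ⁻¹' (ProjSpace.hyperplane k n i) = zeroLocus (s i)

attribute [instance] LineBundle.instAddCommGroup LineBundle.instModule

/-- A line bundle is ample if the nonvanishing loci of global sections of its positive
tensor powers include an affine open cover of `X`. -/
def LineBundle.IsAmple {fX : X ⟶ Spec (CommRingCat.of k)} (L : LineBundle fX) : Prop :=
  ∀ x : X, ∃ (l : ℕ) (s : L.sections l), 0 < l ∧ x ∉ L.zeroLocus s ∧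
    IsAffineOpen ⟨(L.zeroLocus s)ᶜ, (L.zeroLocus_closed s).isOpen_compl⟩


lemma gradeZeroInclusion_surjective (k : Type u) [CommRing k] (n : ℕ) :
    Function.Surjective (gradeZeroInclusion k n) := by
  rintro ⟨p, hp⟩
  refine ⟨p.coeff 0, Subtype.ext ?_⟩
  exact (MvPolynomial.totalDegree_eq_zero_iff_eq_C.mp
    (Nat.le_zero.mp (MvPolynomial.IsHomogeneous.totalDegree_le hp))).symm

instance ProjSpace.isProper_structMap (k : Type u) [Field k] (n : ℕ) :
    IsProper (ProjSpace.structMap k n) := by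
  have : IsScalarTower k (MvPolynomial.homogeneousSubmodule (Fin (n + 1)) k 0)
      (MvPolynomial (Fin (n + 1)) k) :=
    ⟨fun a b c ↦ smul_mul_assoc a (b : MvPolynomial (Fin (n + 1)) k) c⟩
  have : Algebra.FiniteType (MvPolynomial.homogeneousSubmodule (Fin (n + 1)) k 0)
      (MvPolynomial (Fin (n + 1)) k) :=
    Algebra.FiniteType.of_restrictScalars_finiteType k _ _
  have : IsClosedImmersion (Spec.map (CommRingCat.ofHom (gradeZeroInclusion k n))) :=
    IsClosedImmersion.spec_of_surjective _ (gradeZeroInclusion_surjective k n)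
  have : IsProper (Proj.toSpecZero (MvPolynomial.homogeneousSubmodule (Fin (n + 1)) k)) :=
    Proj.instIsProperToSpecZeroOfFiniteTypeSubtypeMemOfNatNat _
  exact MorphismProperty.comp_mem @IsProper _ _ this inferInstance

lemma ProjSpace.isAffineOpen_awayFrom (k : Type u) [Field k] (n : ℕ) (i : Fin (n + 1)) :
    IsAffineOpen (ProjSpace.awayFrom k n i) :=
  Proj.isAffineOpen_basicOpen _ _ (MvPolynomial.isHomogeneous_X k i) one_pos

lemma ProjSpace.coe_awayFrom (k : Type u) [Field k] (n : ℕ) (i : Fin (n + 1)) :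
    (ProjSpace.awayFrom k n i : Set (ProjSpace k n)) = (ProjSpace.hyperplane k n i)ᶜ :=
  ProjectiveSpectrum.basicOpen_eq_zeroLocus_compl _ _

/-- A morphism with closed image is affine if the points of the image admit affine open
neighbourhoods with affine preimage. -/
lemma isAffineHom_of_isClosed_range {X Y : Scheme.{u}} (f : X ⟶ Y)
    (hf : IsClosed (Set.range f))
    (H : ∀ x : X, ∃ U : Y.Opens, f x ∈ U ∧ IsAffineOpen U ∧ IsAffineOpen (f ⁻¹ᵁ U)) :
    IsAffineHom f := by
  refine isAffineHom_of_forall_exists_isAffineOpen f fun y ↦ ?_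
  by_cases hy : y ∈ Set.range f
  · obtain ⟨x, rfl⟩ := hy
    exact H x
  · obtain ⟨_, ⟨U, hU, rfl⟩, hyU, hUV⟩ :=
      Y.isBasis_affineOpens.exists_subset_of_mem_open hy hf.isOpen_compl
    refine ⟨U, hyU, hU, ?_⟩
    have : f ⁻¹ᵁ U = ⊥ := by
      ext x
      simpa using fun hx ↦ hUV hx ⟨x, rfl⟩
    rw [this]
    exact isAffineOpen_bot X

namespace LineBundle

variable {fX : X ⟶ Spec (CommRingCat.of k)} (L : LineBundle fX)

/-- The nonvanishing locus of a section of a tensor power of a line bundle. -/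
def nonvanishingLocus {l : ℕ} (s : L.sections l) : X.Opens :=
  ⟨(L.zeroLocus s)ᶜ, (L.zeroLocus_closed s).isOpen_compl⟩

lemma mem_nonvanishingLocus {l : ℕ} {s : L.sections l} {x : X} :
    x ∈ L.nonvanishingLocus s ↔ x ∉ L.zeroLocus s :=
  Iff.rfl

lemma exists_nonvanishingLocus_eq_of_dvd {l m : ℕ} (hlm : l ∣ m) (hm : 0 < m)
    (s : L.sections l) :
    ∃ t : L.sections m, L.nonvanishingLocus t = L.nonvanishingLocus s := by
  obtain ⟨n, rfl⟩ := hlm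
  suffices H : ∀ n : ℕ, ∃ t : L.sections (l * (n + 1)), L.zeroLocus t = L.zeroLocus s by
    obtain ⟨n, rfl⟩ := Nat.exists_eq_add_one.mpr (Nat.pos_of_mul_pos_left hm)
    obtain ⟨t, ht⟩ := H n
    exact ⟨t, by simp [nonvanishingLocus, ht]⟩
  intro n
  induction n with
  | zero =>
    rw [zero_add, mul_one]
    exact ⟨s, rfl⟩
  | succ n ih =>
    obtain ⟨t, ht⟩ := ih
    exact ⟨L.mul t s, by rw [L.zeroLocus_mul, ht, Set.union_self]⟩

lemma inducedMap_preimage_awayFrom {l n : ℕ} (s : Fin (n + 1) → L.sections l)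
    (h : (⋂ i, L.zeroLocus (s i)) = ∅) (i : Fin (n + 1)) :
    L.inducedMap s h ⁻¹ᵁ ProjSpace.awayFrom k n i = L.nonvanishingLocus (s i) := by
  ext x
  rw [TopologicalSpace.Opens.map_coe, ProjSpace.coe_awayFrom, Set.preimage_compl,
    L.inducedMap_preimage]
  rfl

lemma isProper_inducedMap [IsProper fX] {l n : ℕ} (s : Fin (n + 1) → L.sections l)
    (h : (⋂ i, L.zeroLocus (s i)) = ∅) : IsProper (L.inducedMap s h) := by
  have : IsProper (L.inducedMap s h ≫ ProjSpace.structMap k n) := by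
    rwa [L.inducedMap_over]
  exact .of_comp _ (ProjSpace.structMap k n)

/-- If finitely many sections of a fixed tensor power have affine nonvanishing loci covering
a proper scheme, then every section of that power has affine nonvanishing locus. -/
lemma isAffineOpen_nonvanishingLocus_of_cover [IsProper fX] {l n : ℕ}
    (t : Fin n → L.sections l) (ht : ∀ i, IsAffineOpen (L.nonvanishingLocus (t i)))
    (hcov : ∀ x, ∃ i, x ∈ L.nonvanishingLocus (t i)) (s : L.sections l) :
    IsAffineOpen (L.nonvanishingLocus s) := by
  let σ : Fin (n + 1) → L.sections l := Fin.cons s t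
  have hσ : (⋂ i, L.zeroLocus (σ i)) = ∅ := by
    refine Set.eq_empty_of_forall_notMem fun x hx ↦ ?_
    obtain ⟨i, hi⟩ := hcov x
    exact hi (Set.mem_iInter.mp hx i.succ)
  have := L.isProper_inducedMap σ hσ
  have : IsAffineHom (L.inducedMap σ hσ) := by
    refine isAffineHom_of_isClosed_range _ (L.inducedMap σ hσ).isClosedMap.isClosed_range
      fun x ↦ ?_
    obtain ⟨i, hi⟩ := hcov x
    have hpre : L.inducedMap σ hσ ⁻¹ᵁ ProjSpace.awayFrom k n i.succ =
        L.nonvanishingLocus (t i) := L.inducedMap_preimage_awayFrom σ hσ i.succ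
    refine ⟨ProjSpace.awayFrom k n i.succ, ?_, ProjSpace.isAffineOpen_awayFrom k n i.succ, ?_⟩
    · rwa [← hpre] at hi
    · exact hpre ▸ ht i
  have hpre : L.inducedMap σ hσ ⁻¹ᵁ ProjSpace.awayFrom k n 0 = L.nonvanishingLocus s :=
    L.inducedMap_preimage_awayFrom σ hσ 0
  exact hpre ▸ (ProjSpace.isAffineOpen_awayFrom k n 0).preimage (L.inducedMap σ hσ)

lemma IsAmple.exists_finite_cover {L : LineBundle fX} (hL : L.IsAmple) [CompactSpace X] :
    ∃ (l n : ℕ) (t : Fin n → L.sections l), 0 < l ∧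
      (∀ i, IsAffineOpen (L.nonvanishingLocus (t i))) ∧
      ∀ x, ∃ i, x ∈ L.nonvanishingLocus (t i) := by
  choose d s hd hs haff using hL
  obtain ⟨F, hF⟩ := isCompact_univ.elim_finite_subcover
    (fun x ↦ (L.nonvanishingLocus (s x) : Set X)) (fun x ↦ (L.nonvanishingLocus (s x)).isOpen)
    fun x _ ↦ Set.mem_iUnion.mpr ⟨x, hs x⟩
  have hpos : 0 < ∏ x ∈ F, d x := Finset.prod_pos fun x _ ↦ hd x
  choose t ht using fun x : F ↦ L.exists_nonvanishingLocus_eq_of_dvd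
    (Finset.dvd_prod_of_mem d x.2) hpos (s x)
  refine ⟨_, F.card, fun i ↦ t (F.equivFin.symm i), hpos, fun i ↦ ?_, fun x ↦ ?_⟩
  · rw [ht]
    exact haff _
  · obtain ⟨y, hy, hxy⟩ := Set.mem_iUnion₂.mp (hF (Set.mem_univ x))
    refine ⟨F.equivFin ⟨y, hy⟩, ?_⟩
    beta_reduce
    rw [Equiv.symm_apply_apply, ht]
    exact hxy

end LineBundle

/-- The complement of the zero locus of a global section of an ample line bundle on a
projective scheme over a field is affine. -/
theorem isAffineOpen_compl_zeroLocus
    (fX : X ⟶ Spec (CommRingCat.of k)) (hX : IsProjectiveOver fX)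
    (L : LineBundle fX) (hL : L.IsAmple) (s : L.sections 1) :
    IsAffineOpen ⟨(L.zeroLocus s)ᶜ, (L.zeroLocus_closed s).isOpen_compl⟩ := by
  have : IsProper fX := by
    obtain ⟨N, g, _, rfl⟩ := hX
    infer_instance
  have : CompactSpace X := (quasiCompact_iff_compactSpace fX).mp inferInstance
  obtain ⟨l, n, t, hl, ht, hcov⟩ := hL.exists_finite_cover
  obtain ⟨s', hs'⟩ := L.exists_nonvanishingLocus_eq_of_dvd (one_dvd l) hl s
  change IsAffineOpen (L.nonvanishingLocus s)
  exact hs' ▸ L.isAffineOpen_nonvanishingLocus_of_cover t ht hcov s'
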